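/- There is no continuous map f : S^n → S^{n-1} satisfying f(-x) = -f(x) for all x ∈ S^n. -/

import Mathlib

namespace OrderedChain

open Finsupp

variable {X Y : Type*}

/-- Mod 2 chains on ordered tuples of points, augmented by the empty tuple. -/
abbrev Chain (X : Type*) := List X →₀ ZMod 2

/-- The join of a point with a chain. -/
noncomputable def cons (x : X) : Chain X →ₗ[ZMod 2] Chain X :=
  lmapDomain _ _ (List.cons x)

/-- The chain map induced by a map of points. -/
noncomputable def push (f : X → Y) : Chain X →ₗ[ZMod 2] Chain Y :=
  lmapDomain _ _ (List.map f)

/-- The boundary of a tuple. -/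
noncomputable def boundaryTuple : List X → Chain X
  | [] => 0
  | x :: l => single l 1 + cons x (boundaryTuple l)

/-- The boundary operator. -/
noncomputable def boundary : Chain X →ₗ[ZMod 2] Chain X :=
  linearCombination _ boundaryTuple

/-- The prism over a tuple, joining its images under `f` and `g`. -/
noncomputable def prismTuple (f g : X → Y) : List X → Chain Y
  | [] => 0
  | x :: l => cons (f x) (cons (g x) (push g (single l 1))) + cons (f x) (prismTuple f g l)

/-- The prism operator between `push f` and `push g`. -/
noncomputable def prism (f g : X → Y) : Chain X →ₗ[ZMod 2] Chain Y :=
  linearCombination _ (prismTuple f g)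

@[simp] lemma cons_single (x : X) (l : List X) (a : ZMod 2) :
    cons x (single l a) = single (x :: l) a := by
  simp [cons]

@[simp] lemma push_single (f : X → Y) (l : List X) (a : ZMod 2) :
    push f (single l a) = single (l.map f) a := by
  simp [push]

@[simp] lemma boundary_nil : boundary (single ([] : List X) 1) = 0 := by
  simp [boundary, boundaryTuple]

@[simp] lemma prism_nil (f g : X → Y) : prism f g (single [] 1) = 0 := by
  simp [prism, prismTuple]

lemma add_self (c : Chain X) : c + c = 0 := ZModModule.add_self c

lemma linearMap_eq {M : Type*} [AddCommGroup M] [Module (ZMod 2) M]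
    {F G : Chain X →ₗ[ZMod 2] M} (h : ∀ l, F (single l 1) = G (single l 1)) (c : Chain X) :
    F c = G c := by
  have : F = G := by
    ext l
    simpa using h l
  rw [this]

lemma boundary_cons (x : X) (c : Chain X) :
    boundary (cons x c) = c + cons x (boundary c) :=
  linearMap_eq (F := boundary ∘ₗ cons x) (G := LinearMap.id + cons x ∘ₗ boundary)
    (fun l => by simp [boundary, boundaryTuple]) c

lemma prism_cons (f g : X → Y) (x : X) (c : Chain X) :
    prism f g (cons x c) = cons (f x) (cons (g x) (push g c)) + cons (f x) (prism f g c) :=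
  linearMap_eq (F := prism f g ∘ₗ cons x)
    (G := cons (f x) ∘ₗ cons (g x) ∘ₗ push g + cons (f x) ∘ₗ prism f g)
    (fun l => by simp [prism, prismTuple]) c

lemma push_cons (f : X → Y) (x : X) (c : Chain X) :
    push f (cons x c) = cons (f x) (push f c) :=
  linearMap_eq (F := push f ∘ₗ cons x) (G := cons (f x) ∘ₗ push f) (fun l => by simp) c

lemma push_push {Z : Type*} (f : X → Y) (g : Y → Z) (c : Chain X) :
    push g (push f c) = push (g ∘ f) c :=
  linearMap_eq (F := push g ∘ₗ push f) (G := push (g ∘ f)) (fun l => by simp) c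

lemma push_id (c : Chain X) : push id c = c :=
  linearMap_eq (F := push id) (G := LinearMap.id) (fun l => by simp) c

lemma boundary_push (f : X → Y) (c : Chain X) :
    boundary (push f c) = push f (boundary c) := by
  refine linearMap_eq (F := boundary ∘ₗ push f) (G := push f ∘ₗ boundary) (fun l => ?_) c
  simp only [LinearMap.comp_apply]
  induction l with
  | nil => simp
  | cons x l ih =>
    rw [← cons_single, push_cons, boundary_cons, ih, boundary_cons, map_add, push_cons]

/-- The prism operator is a chain homotopy from `push f` to `push g`. -/
lemma boundary_prism (f g : X → Y) (c : Chain X) :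
    boundary (prism f g c) = prism f g (boundary c) + push g c + push f c := by
  refine linearMap_eq (F := boundary ∘ₗ prism f g)
    (G := prism f g ∘ₗ boundary + push g + push f) (fun l => ?_) c
  simp only [LinearMap.comp_apply, LinearMap.add_apply]
  induction l with
  | nil => simp [add_self]
  | cons x l ih =>
    rw [← cons_single]
    simp only [prism_cons, map_add, boundary_cons, boundary_push, push_cons, ih]
    rw [← sub_eq_zero]
    simp only [ZModModule.sub_eq_add]
    abel_nf
    simp [two_zsmul, CharTwo.two_eq_zero, add_self]

/-- The telescoping sum of the prisms between consecutive members of a sequence of maps. -/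
noncomputable def prismSum (F : ℕ → X → Y) (M : ℕ) : Chain X →ₗ[ZMod 2] Chain Y :=
  ∑ j ∈ Finset.range M, prism (F j) (F (j + 1))

lemma boundary_prismSum (F : ℕ → X → Y) (M : ℕ) {z : Chain X} (hz : boundary z = 0) :
    boundary (prismSum F M z) = push (F M) z + push (F 0) z := by
  induction M with
  | zero => simp [prismSum, add_self]
  | succ M ih =>
    have h : prismSum F (M + 1) z = prismSum F M z + prism (F M) (F (M + 1)) z := by
      simp [prismSum, Finset.sum_range_succ]
    rw [h, map_add, ih, boundary_prism, hz, map_zero, zero_add,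
      show ∀ a b c : Chain Y, a + b + (c + a) = (a + a) + (c + b) by intros; abel, add_self,
      zero_add]

lemma prismTuple_mem (f g : X → Y) (l : List X) :
    prismTuple f g l ∈ supported (ZMod 2) (ZMod 2)
      {m | m.length = l.length + 1 ∧ ∀ z ∈ m, ∃ x ∈ l, z = f x ∨ z = g x} := by
  induction l with
  | nil => exact Submodule.zero_mem _
  | cons x l ih =>
    refine Submodule.add_mem _ ?_ ?_
    · rw [push_single, cons_single, cons_single]
      refine single_mem_supported _ _ ⟨by simp, ?_⟩
      simp only [List.mem_cons, List.mem_map]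
      rintro z (rfl | rfl | ⟨y, hy, rfl⟩)
      exacts [⟨x, .inl rfl, .inl rfl⟩, ⟨x, .inl rfl, .inr rfl⟩, ⟨y, .inr hy, .inr rfl⟩]
    · have h := Submodule.mem_map_of_mem (f := cons (f x)) ih
      rw [cons, lmapDomain_supported] at h
      refine supported_mono ?_ h
      rintro _ ⟨m, ⟨hm, hm'⟩, rfl⟩
      refine ⟨by simp [hm], ?_⟩
      simp only [List.mem_cons]
      rintro z (rfl | hz)
      · exact ⟨x, .inl rfl, .inl rfl⟩
      · obtain ⟨y, hy, h⟩ := hm' z hz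
        exact ⟨y, .inr hy, h⟩

/-- A linear map sends chains supported on `S` into `p` if it does so for tuples in `S`. -/
lemma map_mem {M : Type*} [AddCommGroup M] [Module (ZMod 2) M] (F : Chain X →ₗ[ZMod 2] M)
    {S : Set (List X)} {p : Submodule (ZMod 2) M} (h : ∀ l ∈ S, F (single l 1) ∈ p)
    {c : Chain X} (hc : c ∈ supported (ZMod 2) (ZMod 2) S) : F c ∈ p := by
  rw [supported_eq_span_single] at hc
  have : Submodule.span (ZMod 2) ((fun l => single l (1 : ZMod 2)) '' S) ≤ p.comap F := by
    rw [Submodule.span_le]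
    rintro _ ⟨l, hl, rfl⟩
    exact h l hl
  exact this hc

section Cochains

variable (s : ℕ → X → ZMod 2)

mutual

/-- The product of the sign changes of `s p, s (p + 1), …` along the consecutive edges of a
tuple. -/
def signChange (p : ℕ) : List X → ZMod 2
  | [] => 0
  | x :: l => s p x * signChange (p + 1) l + signPrimitive p l

/-- A cochain with coboundary `signChange s p`. -/
def signPrimitive (p : ℕ) : List X → ZMod 2
  | [] => 1
  | x :: l => s p x * (s (p + 1) x * signChange (p + 2) l + signPrimitive (p + 1) l)

end

/-- Evaluation of a cochain on chains. -/
noncomputable def evaluate (φ : List X → ZMod 2) : Chain X →ₗ[ZMod 2] ZMod 2 :=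
  linearCombination _ φ

@[simp] lemma evaluate_single (φ : List X → ZMod 2) (l : List X) : evaluate φ (single l 1) = φ l := by
  simp [evaluate]

lemma signPrimitive_cons (p : ℕ) (x : X) (l : List X) :
    signPrimitive s p (x :: l) = s p x * signChange s (p + 1) (x :: l) := by
  simp [signPrimitive, signChange]

lemma evaluate_signChange_cons (p : ℕ) (x : X) (c : Chain X) :
    evaluate (signChange s p) (cons x c) =
      s p x * evaluate (signChange s (p + 1)) c + evaluate (signPrimitive s p) c :=
  linearMap_eq (F := evaluate (signChange s p) ∘ₗ cons x)
    (G := s p x • evaluate (signChange s (p + 1)) + evaluate (signPrimitive s p))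
    (fun l => by simp [signChange]) c

lemma evaluate_signPrimitive_cons (p : ℕ) (x : X) (c : Chain X) :
    evaluate (signPrimitive s p) (cons x c) = s p x * evaluate (signChange s (p + 1)) (cons x c) :=
  linearMap_eq (F := evaluate (signPrimitive s p) ∘ₗ cons x)
    (G := s p x • evaluate (signChange s (p + 1)) ∘ₗ cons x)
    (fun l => by simp [signPrimitive_cons]) c

lemma evaluate_boundary_single (l : List X) (p : ℕ) :
    evaluate (signChange s p) (boundary (single l 1)) = 0 ∧
      evaluate (signPrimitive s p) (boundary (single l 1)) = signChange s p l := by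
  induction l generalizing p with
  | nil => simp [signChange]
  | cons x l ih =>
    have h (q : ℕ) : evaluate (signChange s q) (boundary (single (x :: l) 1)) = 0 := by
      rw [← cons_single, boundary_cons, map_add, evaluate_signChange_cons, (ih _).1, (ih _).2,
        evaluate_single, mul_zero, zero_add, CharTwo.add_self_eq_zero]
    refine ⟨h p, ?_⟩
    have h' := h (p + 1)
    rw [← cons_single, boundary_cons, map_add, evaluate_single, CharTwo.add_eq_zero] at h'
    rw [← cons_single, boundary_cons, map_add, evaluate_signPrimitive_cons, ← h', evaluate_single,
      signChange, add_comm]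

lemma evaluate_signPrimitive_boundary (p : ℕ) (c : Chain X) :
    evaluate (signPrimitive s p) (boundary c) = evaluate (signChange s p) c :=
  linearMap_eq (F := evaluate (signPrimitive s p) ∘ₗ boundary) (G := evaluate (signChange s p))
    (fun l => by simpa using (evaluate_boundary_single s l p).2) c

variable {s} {T : X → X}

lemma signChange_map {l : List X} (h : ∀ i, ∀ x ∈ l, s i (T x) = s i x + 1) (p : ℕ) :
    signChange s p (l.map T) = signChange s p l ∧
      signPrimitive s p (l.map T) = signPrimitive s p l + signChange s (p + 1) l := by
  induction l generalizing p with
  | nil => simp [signChange, signPrimitive]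
  | cons x l ih =>
    have ih := ih fun i y hy => h i y (List.mem_cons_of_mem _ hy)
    have hx (i : ℕ) := h i x List.mem_cons_self
    have key (q : ℕ) : signChange s q ((x :: l).map T) = signChange s q (x :: l) := by
      rw [List.map_cons, signChange, signChange, (ih _).1, (ih _).2, hx]
      linear_combination CharTwo.add_self_eq_zero (signChange s (q + 1) l)
    refine ⟨key p, ?_⟩
    rw [List.map_cons, signPrimitive_cons, ← List.map_cons, key, hx, signPrimitive_cons]
    ring

/-- Passing to a filling of the antipodal cycle of `h` lowers the index of `signChange`. -/
lemma evaluate_signChange_of_boundary {S : Set (List X)}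
    (hS : ∀ l ∈ S, ∀ i, ∀ x ∈ l, s i (T x) = s i x + 1) {h h' : Chain X}
    (hh : h ∈ supported (ZMod 2) (ZMod 2) S) (hb : boundary h' = h + push T h) (p : ℕ) :
    evaluate (signChange s p) h' = evaluate (signChange s (p + 1)) h := by
  rw [← evaluate_signPrimitive_boundary, hb]
  have := map_mem (p := ⊥) (evaluate (signPrimitive s p) ∘ₗ (LinearMap.id + push T) +
    evaluate (signChange s (p + 1))) (fun l hl => ?_) hh
  · simpa [CharTwo.add_eq_zero] using this
  · simp only [LinearMap.add_apply, LinearMap.comp_apply, LinearMap.id_apply, map_add,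
      push_single, evaluate_single, (signChange_map (hS l hl) p).2, Submodule.mem_bot]
    linear_combination CharTwo.add_self_eq_zero (signPrimitive s p l) +
      CharTwo.add_self_eq_zero (signChange s (p + 1) l)

lemma exists_sign_ne {l : List X} {p : ℕ} (h : signChange s p l ≠ 0) {i : ℕ}
    (hi : i + 1 < l.length) : ∃ x ∈ l, ∃ y ∈ l, s (p + i) x ≠ s (p + i) y := by
  induction l generalizing p i with
  | nil => simp at hi
  | cons x l ih =>
    obtain _ | ⟨y, l⟩ := l
    · simp at hi
    rw [signChange, signPrimitive_cons, ← add_mul] at h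
    obtain _ | i := i
    · refine ⟨x, by simp, y, by simp, fun h' => left_ne_zero_of_mul h ?_⟩
      simp only [add_zero] at h'
      rw [h', CharTwo.add_self_eq_zero]
    · obtain ⟨a, ha, b, hb, hab⟩ := ih (right_ne_zero_of_mul h) (i := i) (by simpa using hi)
      rw [add_assoc, add_comm 1] at hab
      exact ⟨a, .tail _ ha, b, .tail _ hb, hab⟩

end Cochains

section Fillings

variable {n : ℕ}

/-- The sphere of the `ℓ¹` norm in the first `k + 1` coordinates. -/
def crossSphere (n k : ℕ) : Set (Fin (n + 1) → ℝ) :=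
  {x | ∑ i, |x i| = 1 ∧ ∀ i : Fin (n + 1), k < i → x i = 0}

/-- Tuples of `k + 1` points of `crossSphere n k` at mutual distance at most `ε`. -/
def smallTuples (n k : ℕ) (ε : ℝ) : Set (List (Fin (n + 1) → ℝ)) :=
  {l | l.length = k + 1 ∧ (∀ x ∈ l, x ∈ crossSphere n k) ∧ ∀ x ∈ l, ∀ y ∈ l, dist x y ≤ ε}

lemma abs_le_one_of_mem_crossSphere {k : ℕ} {x : Fin (n + 1) → ℝ} (hx : x ∈ crossSphere n k)
    (i : Fin (n + 1)) :
    |x i| ≤ 1 :=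
  hx.1 ▸ Finset.single_le_sum (f := fun i => |x i|) (fun _ _ => abs_nonneg _) (Finset.mem_univ i)

lemma ne_zero_of_mem_crossSphere {k : ℕ} {x : Fin (n + 1) → ℝ} (hx : x ∈ crossSphere n k) :
    x ≠ 0 := by
  rintro rfl
  simpa using hx.1

lemma neg_mem_crossSphere {k : ℕ} {x : Fin (n + 1) → ℝ} (hx : x ∈ crossSphere n k) :
    -x ∈ crossSphere n k :=
  ⟨by simpa using hx.1, fun i hi => by simp [hx.2 i hi]⟩

lemma map_neg_mem_smallTuples {k : ℕ} {ε : ℝ} {l : List (Fin (n + 1) → ℝ)}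
    (hl : l ∈ smallTuples n k ε) :
    l.map Neg.neg ∈ smallTuples n k ε := by
  refine ⟨by simpa using hl.1, ?_, ?_⟩
  · simp only [List.mem_map]
    rintro _ ⟨x, hx, rfl⟩
    exact neg_mem_crossSphere (hl.2.1 x hx)
  · simp only [List.mem_map]
    rintro _ ⟨x, hx, rfl⟩ _ ⟨y, hy, rfl⟩
    rw [dist_neg_neg]
    exact hl.2.2 x hx y hy

lemma single_mem_crossSphere {k : ℕ} (hk : k < n + 1) :
    (Pi.single ⟨k, hk⟩ 1 : Fin (n + 1) → ℝ) ∈ crossSphere n k := by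
  refine ⟨?_, fun i hi => Pi.single_eq_of_ne (by rintro rfl; simp at hi) _⟩
  rw [Finset.sum_eq_single ⟨k, hk⟩] <;> simp +contextual

/-- The straight-line contraction to the `k`-th basis vector. -/
noncomputable def contract {k : ℕ} (hk : k < n + 1) (t : ℝ) (x : Fin (n + 1) → ℝ) :
    Fin (n + 1) → ℝ :=
  (1 - t) • x + t • Pi.single ⟨k, hk⟩ 1

lemma contract_mem_crossSphere {k : ℕ} (hk : k + 1 < n + 1) {t : ℝ} (ht : t ∈ Set.Icc 0 1)
    {x : Fin (n + 1) → ℝ} (hx : x ∈ crossSphere n k) :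
    contract hk t x ∈ crossSphere n (k + 1) := by
  have he := single_mem_crossSphere hk
  refine ⟨?_, fun i hi => ?_⟩
  · have h (i : Fin (n + 1)) : |contract hk t x i| =
        (1 - t) * |x i| + t * |(Pi.single ⟨k + 1, hk⟩ 1 : Fin (n + 1) → ℝ) i| := by
      by_cases hi : i = ⟨k + 1, hk⟩
      · have : x i = 0 := hx.2 i (by simp [hi])
        simp [contract, hi ▸ this, hi, abs_of_nonneg ht.1]
      · simp [contract, Pi.single_eq_of_ne hi, abs_mul, abs_of_nonneg (sub_nonneg.2 ht.2)]
    rw [Finset.sum_congr rfl fun i _ => h i, Finset.sum_add_distrib, ← Finset.mul_sum,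
      ← Finset.mul_sum, hx.1, he.1]
    ring
  · simp [contract, hx.2 i (by omega), he.2 i hi]

lemma dist_contract_le {k : ℕ} (hk : k + 1 < n + 1) {t u : ℝ} (ht : t ∈ Set.Icc 0 1)
    {x y : Fin (n + 1) → ℝ} (hy : y ∈ crossSphere n k) :
    dist (contract hk t x) (contract hk u y) ≤ dist x y + 2 * |t - u| := by
  have he := single_mem_crossSphere hk
  refine (dist_pi_le_iff (by positivity)).2 fun i => ?_
  have h1 : |x i - y i| ≤ dist x y := dist_le_pi_dist x y i
  set e : Fin (n + 1) → ℝ := Pi.single ⟨k + 1, hk⟩ 1 with hedef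
  have h2 : |e i - y i| ≤ 2 := by
    have := abs_sub (e i) (y i)
    linarith [abs_le_one_of_mem_crossSphere he i, abs_le_one_of_mem_crossSphere hy i]
  have h3 : contract hk t x i - contract hk u y i =
      (1 - t) * (x i - y i) + (t - u) * (e i - y i) := by
    simp only [contract, Pi.add_apply, Pi.smul_apply, smul_eq_mul, ← hedef]
    ring
  rw [Real.dist_eq, h3]
  refine (abs_add_le _ _).trans ?_
  rw [abs_mul, abs_mul, abs_of_nonneg (sub_nonneg.2 ht.2)]
  have : (1 - t) * |x i - y i| ≤ 1 * |x i - y i| := by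
    gcongr
    linarith [ht.1]
  nlinarith [abs_nonneg (t - u)]

lemma push_neg_mem_supported {k : ℕ} {ε : ℝ} {h : Chain (Fin (n + 1) → ℝ)}
    (hh : h ∈ supported (ZMod 2) (ZMod 2) (smallTuples n k ε)) :
    push Neg.neg h ∈ supported (ZMod 2) (ZMod 2) (smallTuples n k ε) :=
  map_mem (push Neg.neg) (fun l hl => by
    rw [push_single]
    exact single_mem_supported _ _ (map_neg_mem_smallTuples hl)) hh

/-- The antipodal cycle of a small chain bounds a small chain one dimension up. -/
lemma exists_filling {k : ℕ} (hk : k + 1 < n + 1) {ε : ℝ} (hε : 0 < ε)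
    {h : Chain (Fin (n + 1) → ℝ)}
    (hh : h ∈ supported (ZMod 2) (ZMod 2) (smallTuples n k (ε / 2)))
    (hb : boundary (h + push Neg.neg h) = 0) :
    ∃ h' ∈ supported (ZMod 2) (ZMod 2) (smallTuples n (k + 1) ε),
      boundary h' = h + push Neg.neg h := by
  obtain ⟨M, hM⟩ := exists_nat_gt (4 / ε)
  have hM0 : (0 : ℝ) < M := lt_trans (by positivity) hM
  let F : ℕ → (Fin (n + 1) → ℝ) → Fin (n + 1) → ℝ := fun j => contract hk (j / M)
  refine ⟨prismSum F M (h + push Neg.neg h), ?_, ?_⟩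
  · refine map_mem _ (fun l hl => ?_) (Submodule.add_mem _ hh (push_neg_mem_supported hh))
    rw [prismSum, LinearMap.sum_apply]
    refine Submodule.sum_mem _ fun j hj => ?_
    have hj : j + 1 ≤ M := Finset.mem_range.1 hj
    rw [prism, linearCombination_single, one_smul]
    refine supported_mono ?_ (prismTuple_mem _ _ l)
    have time {i : ℕ} (hi : i ≤ M) : (i / M : ℝ) ∈ Set.Icc 0 1 :=
      ⟨by positivity, (div_le_one hM0).2 (by exact_mod_cast hi)⟩
    have step : 2 * (1 / M : ℝ) ≤ ε / 2 := by
      rw [div_lt_iff₀ hε] at hM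
      rw [mul_one_div, div_le_iff₀ hM0]
      linarith
    rintro m ⟨hm, hm'⟩
    have hm' : ∀ z ∈ m, ∃ x ∈ l, ∃ i : ℕ, (i = j ∨ i = j + 1) ∧ z = F i x := fun z hz => by
      obtain ⟨x, hx, h | h⟩ := hm' z hz
      exacts [⟨x, hx, j, .inl rfl, h⟩, ⟨x, hx, j + 1, .inr rfl, h⟩]
    refine ⟨by rw [hm, hl.1], fun z hz => ?_, fun z hz w hw => ?_⟩
    · obtain ⟨x, hx, i, hi, rfl⟩ := hm' z hz
      exact contract_mem_crossSphere hk (time (by omega)) (hl.2.1 x hx)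
    · obtain ⟨x, hx, i, hi, rfl⟩ := hm' z hz
      obtain ⟨y, hy, i', hi', rfl⟩ := hm' w hw
      refine (dist_contract_le hk (time (by omega)) (hl.2.1 y hy)).trans ?_
      have h1 := hl.2.2 x hx y hy
      have h2 : |(i / M - i' / M : ℝ)| ≤ 1 / M := by
        rw [← sub_div, abs_div, abs_of_pos hM0]
        gcongr
        obtain rfl | rfl := hi <;> obtain rfl | rfl := hi' <;> simp
      linarith
  · have h0 : F 0 = id := by
      funext x
      simp [F, contract]
    have h1 : F M ∘ Neg.neg = F M := by
      funext x
      simp [F, contract, div_self hM0.ne']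
    rw [boundary_prismSum F M hb, h0, push_id, map_add, push_push, h1, add_self, zero_add]

lemma boundary_add_push_eq_zero {h h' : Chain (Fin (n + 1) → ℝ)}
    (hb : boundary h' = h + push Neg.neg h) : boundary (h' + push Neg.neg h') = 0 := by
  rw [map_add, boundary_push, hb, map_add, push_push,
    show (Neg.neg ∘ Neg.neg : (Fin (n + 1) → ℝ) → _) = id from funext neg_neg, push_id,
    add_comm (push _ h), add_self]

/-- There are arbitrarily fine chains on which every `signChange` cochain evaluates to `1`. -/
lemma exists_small_chain {s : ℕ → (Fin (n + 1) → ℝ) → ZMod 2}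
    (hs : ∀ i, ∀ x ≠ 0, s i (-x) = s i x + 1) {k : ℕ} (hk : k < n + 1) {ε : ℝ} (hε : 0 < ε) :
    ∃ h ∈ supported (ZMod 2) (ZMod 2) (smallTuples n k ε),
      boundary (h + push Neg.neg h) = 0 ∧ ∀ p, evaluate (signChange s p) h = 1 := by
  induction k generalizing ε with
  | zero =>
    refine ⟨single [Pi.single ⟨0, hk⟩ 1] 1, single_mem_supported _ _ ⟨rfl, ?_, ?_⟩, ?_, ?_⟩
    · simpa using single_mem_crossSphere hk
    · simpa using hε.le
    · simp [← cons_single, boundary_cons, push_cons, add_self]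
    · simp [signChange, signPrimitive]
  | succ k ih =>
    obtain ⟨h, hh, hb, he⟩ := ih (by omega) (half_pos hε)
    obtain ⟨h', hh', hb'⟩ := exists_filling hk hε hh hb
    refine ⟨h', hh', boundary_add_push_eq_zero hb', fun p => ?_⟩
    rw [evaluate_signChange_of_boundary
      (fun l hl i x hx => hs i x (ne_zero_of_mem_crossSphere (hl.2.1 x hx))) hh hb', he]

/-- For antipodal signs, there is a small tuple along which all the signs `s i`, `i < n`,
change. -/
lemma exists_small_tuple {s : ℕ → (Fin (n + 1) → ℝ) → ZMod 2}
    (hs : ∀ i, ∀ x ≠ 0, s i (-x) = s i x + 1) {ε : ℝ} (hε : 0 < ε) :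
    ∃ l ∈ smallTuples n n ε, ∀ i < n, ∃ x ∈ l, ∃ y ∈ l, s i x ≠ s i y := by
  obtain ⟨h, hh, -, he⟩ := exists_small_chain hs n.lt_succ_self hε
  by_contra! hcon
  have := map_mem (p := ⊥) (evaluate (signChange s 0)) (fun l hl => ?_) hh
  · simp [he] at this
  · rw [evaluate_single, Submodule.mem_bot]
    by_contra hne
    obtain ⟨i, hi, hl'⟩ := hcon l hl
    obtain ⟨x, hx, y, hy, hxy⟩ := exists_sign_ne hne (i := i) (by rw [hl.1]; omega)
    rw [zero_add] at hxy
    exact hxy (hl' x hx y hy)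

end Fillings

end OrderedChain

open OrderedChain

lemma isCompact_crossSphere (n k : ℕ) : IsCompact (crossSphere n k) := by
  refine (isCompact_closedBall (0 : Fin (n + 1) → ℝ) 1).of_isClosed_subset ?_ fun x hx => ?_
  · have : crossSphere n k =
        {x | ∑ i, |x i| = 1} ∩ ⋂ i : Fin (n + 1), ⋂ _ : k < i, {x | x i = 0} := by
      ext
      simp [crossSphere]
    rw [this]
    exact (isClosed_eq (by fun_prop) continuous_const).inter <| isClosed_iInter fun i =>
      isClosed_iInter fun _ => isClosed_eq (continuous_apply i) continuous_const
  · rw [mem_closedBall_zero_iff]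
    exact (pi_norm_le_iff_of_nonneg zero_le_one).2 fun i => abs_le_one_of_mem_crossSphere hx i

open Classical in
/-- The sign of an odd real function, with ties broken by a well-ordering. -/
noncomputable def oddSign {X : Type*} [Neg X] (u : X → ℝ) (x : X) : ZMod 2 :=
  if 0 < u x ∨ (u x = 0 ∧ WellOrderingRel x (-x)) then 1 else 0

lemma oddSign_neg {E : Type*} [AddCommGroup E] [IsAddTorsionFree E] {u : E → ℝ}
    (hu : ∀ x, u (-x) = -u x) {x : E} (hx : x ≠ 0) : oddSign u (-x) = oddSign u x + 1 := by
  have hne : x ≠ -x := fun h => hx (self_eq_neg.1 h)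
  have h11 : (1 : ZMod 2) + 1 = 0 := by decide
  unfold oddSign
  rw [hu, neg_neg]
  obtain h | h | h := lt_trichotomy (u x) 0
  · simp [h, h.not_gt, h.ne]
  · obtain h' | h' | h' := trichotomous_of WellOrderingRel x (-x)
    · simp [h, h', asymm h', h11]
    · exact absurd h' hne
    · simp [h, h', asymm h']
  · simp [h, h.not_gt, h.ne', h11]

lemma abs_le_abs_sub_of_oddSign_ne {X : Type*} [Neg X] {u : X → ℝ} {x y : X}
    (h : oddSign u x ≠ oddSign u y) : |u x| ≤ |u x - u y| := by
  have : (0 ≤ u x ∧ u y ≤ 0) ∨ (u x ≤ 0 ∧ 0 ≤ u y) := by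
    by_contra! hcon
    refine h ?_
    unfold oddSign
    obtain hx | hx | hx := lt_trichotomy (u x) 0
    · have hy := hcon.2 hx.le
      simp [hx.not_gt, hx.ne, hy.not_gt, hy.ne]
    · exact absurd (hcon.1 hx.ge) (hcon.2 hx.le).not_gt
    · simp [hx, hcon.1 hx.le]
  obtain ⟨hx, hy⟩ | ⟨hx, hy⟩ := this
  · rw [abs_of_nonneg hx]
    exact le_trans (by linarith) (le_abs_self _)
  · rw [abs_of_nonpos hx]
    exact le_trans (by linarith) (neg_le_abs _)

/-- An odd map `ℝⁿ⁺¹ → ℝⁿ`, continuous away from `0`, vanishes at a nonzero point. -/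
theorem exists_eq_zero_of_odd {n : ℕ} {g : (Fin (n + 1) → ℝ) → Fin n → ℝ}
    (hg : ContinuousOn g {0}ᶜ) (hodd : ∀ x, g (-x) = -g x) : ∃ x ≠ 0, g x = 0 := by
  by_contra! hne
  have hK := isCompact_crossSphere n n
  have hgK : ContinuousOn g (crossSphere n n) := hg.mono fun x hx => ne_zero_of_mem_crossSphere hx
  obtain ⟨x₀, hx₀, hmin⟩ :=
    hK.exists_isMinOn ⟨_, single_mem_crossSphere n.lt_succ_self⟩ hgK.norm
  set c := ‖g x₀‖ with hc
  have hc0 : 0 < c := norm_pos_iff.2 (hne x₀ (ne_zero_of_mem_crossSphere hx₀))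
  obtain ⟨δ, hδ, hunif⟩ := Metric.uniformContinuousOn_iff.1
    (hK.uniformContinuousOn_of_continuous hgK) (c / 3) (by positivity)
  let u : ℕ → (Fin (n + 1) → ℝ) → ℝ := fun i x => if h : i < n then g x ⟨i, h⟩ else 0
  have hu (i : ℕ) (x) : u i (-x) = -u i x := by
    by_cases h : i < n <;> simp [u, h, hodd]
  obtain ⟨l, hl, hsign⟩ := exists_small_tuple (s := fun i => oddSign (u i))
    (fun i x hx => oddSign_neg (hu i) hx) (half_pos hδ)
  obtain ⟨z, hz⟩ : ∃ z, z ∈ l :=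
    List.exists_mem_of_length_pos (by rw [hl.1]; exact n.succ_pos)
  have close {x y} (hx : x ∈ l) (hy : y ∈ l) (i : Fin n) : |g x i - g y i| ≤ c / 3 :=
    (dist_le_pi_dist (g x) (g y) i).trans (hunif x (hl.2.1 x hx) y (hl.2.1 y hy)
      ((hl.2.2 x hx y hy).trans_lt (half_lt_self hδ))).le
  have hzc : ‖g z‖ ≤ 2 * c / 3 := by
    refine (pi_norm_le_iff_of_nonneg (by positivity)).2 fun i => ?_
    obtain ⟨x, hx, y, hy, hxy⟩ := hsign i i.2
    have h1 : |g x i| ≤ |g x i - g y i| := by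
      simpa [u] using abs_le_abs_sub_of_oddSign_ne hxy
    have h2 := abs_add_le (g z i - g x i) (g x i)
    rw [sub_add_cancel] at h2
    rw [Real.norm_eq_abs]
    linarith [close hz hx i, close hx hy i]
  have : c ≤ ‖g z‖ := hmin (hl.2.1 z hz)
  linarith

/-- There is no continuous odd (antipodal) map `S^n → S^{n-1}`: no continuous
`f` from the unit sphere of `ℝ^{n+1}` to the unit sphere of `ℝ^n` satisfies
`f (-x) = - f x` for all `x`. -/
theorem no_continuous_odd_map_sphere (n : ℕ) (hn : 1 ≤ n) :
    ¬ ∃ f : Metric.sphere (0 : EuclideanSpace ℝ (Fin (n + 1))) 1 →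
            Metric.sphere (0 : EuclideanSpace ℝ (Fin n)) 1,
        Continuous f ∧ ∀ x, f (-x) = -f x := by
  rintro ⟨f, hf, hodd⟩
  let φ (x : Fin (n + 1) → ℝ) (hx : x ≠ 0) :
      Metric.sphere (0 : EuclideanSpace ℝ (Fin (n + 1))) 1 :=
    ⟨(‖WithLp.toLp 2 x‖⁻¹ : ℝ) • WithLp.toLp 2 x, by
      have : ‖WithLp.toLp 2 x‖ ≠ 0 := by simpa using hx
      simp [norm_smul, this]⟩
  have hφ (x) (hx : x ≠ 0) : φ (-x) (neg_ne_zero.2 hx) = -φ x hx := by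
    ext1
    simp [φ]
  let g : (Fin (n + 1) → ℝ) → Fin n → ℝ := fun x =>
    if hx : x ≠ 0 then WithLp.ofLp (f (φ x hx)).1 else 0
  have hgφ (x) (hx : x ≠ 0) : g x = WithLp.ofLp (f (φ x hx)).1 := dif_pos hx
  have hcont : ContinuousOn g {0}ᶜ := by
    rw [continuousOn_iff_continuous_domRestrict]
    have : ({0}ᶜ : Set (Fin (n + 1) → ℝ)).domRestrict g =
        fun x => WithLp.ofLp (f (φ x.1 x.2)).1 := funext fun x => hgφ x.1 x.2
    rw [this]
    refine (PiLp.continuous_ofLp 2 _).comp (continuous_subtype_val.comp (hf.comp ?_))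
    have hc : Continuous fun x : ({0}ᶜ : Set (Fin (n + 1) → ℝ)) =>
        WithLp.toLp 2 x.1 := (PiLp.continuous_toLp 2 _).comp continuous_subtype_val
    refine Continuous.subtype_mk ((hc.norm.inv₀ fun x => ?_).smul hc) _
    have hx : x.1 ≠ 0 := x.2
    simpa using hx
  have hg (x) : g (-x) = -g x := by
    by_cases hx : x = 0
    · simp [g, hx]
    · rw [hgφ x hx, hgφ (-x) (neg_ne_zero.2 hx), hφ x hx, hodd]
      simp
  obtain ⟨x, hx, hgx⟩ := exists_eq_zero_of_odd hcont hg
  rw [hgφ x hx] at hgx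
  have h1 : ‖(f (φ x hx)).1‖ = 1 := by simp
  rw [(WithLp.ofLp_eq_zero 2).1 hgx, norm_zero] at h1
  exact zero_ne_one h1
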